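/- Let N ≥ 1 be a natural number. Then for every integer p ≥ 0, Σ_{n=0}^{p} binom(p, n) · (N−1)_n / ( n! · (N+n−1)_n · (N+2n)_{p−n} ) = 1/p!. -/

import Mathlib

/-- Pochhammer symbol `(x)_k = x (x+1) ⋯ (x+k-1)`, with `(x)_0 = 1`. -/
noncomputable def poch (x : ℝ) (k : ℕ) : ℝ := ∏ i ∈ Finset.range k, (x + i)

theorem poch_add (x : ℝ) (a b : ℕ) : poch x (a + b) = poch x a * poch (x + a) b := by
  simp only [poch, Finset.prod_range_add, Nat.cast_add, add_assoc]

theorem poch_zero (x : ℝ) : poch x 0 = 1 := by simp [poch]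

theorem poch_one (x : ℝ) : poch x 1 = x := by simp [poch]

theorem poch_succ (x : ℝ) (k : ℕ) : poch x (k + 1) = poch x k * (x + k) := by
  rw [poch_add, poch_one]

theorem poch_succ_left (x : ℝ) (k : ℕ) : poch x (k + 1) = x * poch (x + 1) k := by
  rw [add_comm, poch_add, poch_one, Nat.cast_one]

theorem poch_pos {x : ℝ} (hx : 0 < x) (k : ℕ) : 0 < poch x k :=
  Finset.prod_pos fun _ _ => by positivity

/-- The `n`-th summand of the identity at level `p`, for a real parameter `x`. -/
noncomputable def pochTerm (x : ℝ) (p n : ℕ) : ℝ :=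
  (Nat.choose p n : ℝ) * poch (x - 1) n /
    ((Nat.factorial n : ℝ) * poch (x + n - 1) n * poch (x + 2 * n) (p - n))

/-- The Wilf–Zeilberger companion of `pochTerm`. -/
noncomputable def pochCompanion (x : ℝ) (p m : ℕ) : ℝ :=
  (Nat.choose p m : ℝ) * poch (x - 1) (m + 1) /
    ((Nat.factorial m : ℝ) * poch (x + m) (p + 1))

theorem pochTerm_sub_zero {x : ℝ} (hx : 0 < x) (p : ℕ) :
    (p + 1) * pochTerm x (p + 1) 0 - pochTerm x p 0 = -pochCompanion x p 0 := by
  have h := poch_pos hx p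
  have hp : x + p ≠ 0 := by positivity
  simp only [pochTerm, pochCompanion, Nat.choose_zero_right, poch_zero, poch_one, Nat.sub_zero,
    Nat.cast_zero, mul_zero, add_zero, zero_add, Nat.factorial_zero, Nat.cast_one, poch_succ x p]
  field_simp
  ring

theorem pochTerm_sub_succ {x : ℝ} (hx : 0 < x) (m k : ℕ) :
    ((m + 1 + k : ℕ) + 1) * pochTerm x (m + 1 + k + 1) (m + 1) - pochTerm x (m + 1 + k) (m + 1) =
      pochCompanion x (m + 1 + k) m - pochCompanion x (m + 1 + k) (m + 1) := by
  have hP := poch_pos (x := x + m) (by positivity) (m + 1)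
  have hQ := poch_pos (x := x + 2 * (m + 1)) (by positivity) k
  have hchoose : (Nat.choose (m + 1 + k) (m + 1) : ℝ) * (m + 1) =
      Nat.choose (m + 1 + k) m * (k + 1) := by
    have h := Nat.choose_succ_right_eq (m + 1 + k) m
    rw [show m + 1 + k - m = k + 1 by lia] at h
    exact_mod_cast h
  have hden : poch (x + m) (m + 1 + k + 1) =
      poch (x + m) (m + 1) * ((x + 2 * m + 1) * poch (x + 2 * (m + 1)) k) := by
    rw [add_assoc, poch_add _ (m + 1), poch_succ_left _ k]
    push_cast
    ring_nf
  have hden' : poch (x + (m + 1)) (m + 1 + k + 1) =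
      poch (x + m) (m + 1) * ((x + 2 * m + 1) * poch (x + 2 * (m + 1)) k) *
        (x + 2 * (m + 1) + k) / (x + m) := by
    have h := poch_succ_left (x + m) (m + 1 + k + 1)
    rw [poch_succ, hden, add_assoc x (m : ℝ) 1] at h
    rw [eq_div_iff (by positivity), mul_comm, ← h]
    push_cast
    ring
  have hC : (Nat.choose (m + 1 + k) m : ℝ) =
      Nat.choose (m + 1 + k) (m + 1) * (m + 1) / (k + 1) := by
    rw [hchoose]
    field_simp
  simp only [pochTerm, pochCompanion]
  rw [show m + 1 + k + 1 - (m + 1) = k + 1 by lia, show m + 1 + k - (m + 1) = k by lia,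
    Nat.choose_succ_succ, Nat.factorial_succ, poch_succ _ (m + 1)]
  push_cast
  rw [show x + ((m : ℝ) + 1) - 1 = x + m by ring, poch_succ _ k, hden', hden, hC]
  have h1 : x + 2 * ((m : ℝ) + 1) + k ≠ 0 := by positivity
  have h2 : x + 2 * (m : ℝ) + 1 ≠ 0 := by positivity
  have h3 : x + (m : ℝ) ≠ 0 := by positivity
  generalize poch (x + m) (m + 1) = P at *
  generalize poch (x + 2 * (m + 1)) k = Q at *
  field_simp
  ring

theorem sum_pochTerm_sub {x : ℝ} (hx : 0 < x) (p m : ℕ) (hm : m ≤ p) :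
    ∑ n ∈ Finset.range (m + 1), ((p + 1) * pochTerm x (p + 1) n - pochTerm x p n) =
      -pochCompanion x p m := by
  induction m with
  | zero => simpa using pochTerm_sub_zero hx p
  | succ m ih =>
    obtain ⟨k, rfl⟩ := Nat.exists_eq_add_of_le hm
    rw [Finset.sum_range_succ, ih (by lia), pochTerm_sub_succ hx]
    ring

theorem pochTerm_self {x : ℝ} (p : ℕ) :
    (p + 1) * pochTerm x (p + 1) (p + 1) = pochCompanion x p p := by
  simp only [pochTerm, pochCompanion, Nat.choose_self, Nat.sub_self, poch_zero, Nat.factorial_succ]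
  push_cast
  rw [show x + ((p : ℝ) + 1) - 1 = x + p by ring, mul_one, mul_assoc, ← mul_div_assoc,
    mul_div_mul_left _ _ (by positivity)]

theorem sum_pochTerm {x : ℝ} (hx : 0 < x) (p : ℕ) :
    ∑ n ∈ Finset.range (p + 1), pochTerm x p n = 1 / (Nat.factorial p : ℝ) := by
  induction p with
  | zero => simp [pochTerm, poch_zero]
  | succ p ih =>
    have h := sum_pochTerm_sub hx p p le_rfl
    rw [Finset.sum_sub_distrib, ih, ← Finset.mul_sum, ← pochTerm_self] at h
    rw [Finset.sum_range_succ, Nat.factorial_succ, Nat.cast_mul, Nat.cast_succ, mul_comm,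
      ← div_div, eq_div_iff (by positivity)]
    linarith

theorem stmt7 (N : ℕ) (hN : 1 ≤ N) (p : ℕ) :
    ∑ n ∈ Finset.range (p + 1),
      (Nat.choose p n : ℝ) * poch ((N : ℝ) - 1) n /
        ((Nat.factorial n : ℝ) * poch ((N : ℝ) + n - 1) n *
          poch ((N : ℝ) + 2 * n) (p - n)) =
      1 / (Nat.factorial p : ℝ) :=
  sum_pochTerm (Nat.cast_pos.mpr hN) p
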